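/- arXiv:1203.6739 — 4 statements merged into one kernel-verified Lean document; each statement's English description precedes it below -/
import Mathlib

section
/- For every real m ≥ 1 there exists a constant C_m > 0 (depending only on m) such that for all real numbers u₁ ≥ u₂ > 0 one has u₁^(m−1) − u₂^(m−1) ≤ C_m · (u₁^m − u₂^m)/(u₁ + u₂). -/
/-- For every real `m ≥ 1` there exists a constant `C_m > 0` (depending only on `m`)
such that for all reals `u₁ ≥ u₂ > 0` one has
`u₁^(m−1) − u₂^(m−1) ≤ C_m · (u₁^m − u₂^m)/(u₁ + u₂)` (real powers via `Real.rpow`). -/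
theorem stmt_0 (m : ℝ) (hm : 1 ≤ m) :
    ∃ C : ℝ, 0 < C ∧ ∀ u₁ u₂ : ℝ, 0 < u₂ → u₂ ≤ u₁ →
      u₁ ^ (m - 1) - u₂ ^ (m - 1) ≤ C * (u₁ ^ m - u₂ ^ m) / (u₁ + u₂) := by
  refine ⟨2, two_pos, fun u₁ u₂ h₂ h => ?_⟩
  have h₁ : 0 < u₁ := h₂.trans_le h
  have rpow_eq {u : ℝ} (hu : 0 < u) : u ^ m = u ^ (m - 1) * u := by
    rw [← Real.rpow_add_one hu.ne', sub_add_cancel]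
  have p₁ : 0 < u₁ ^ (m - 1) := Real.rpow_pos_of_pos h₁ _
  have p₂ : 0 < u₂ ^ (m - 1) := Real.rpow_pos_of_pos h₂ _
  rw [le_div_iff₀ (by positivity), rpow_eq h₁, rpow_eq h₂]
  nlinarith [mul_nonneg (sub_nonneg.2 h) (add_pos p₁ p₂).le]
end

section
/- Fix m > 1, A > 0, δ₀ > 0 and K₁ > 0. Set K₃ = Aπ²/m, K = (m−1)·K₃·δ₀^{m−1}, δ(t) = δ₀·(1+Kt)^{−1/(m−1)}, η(t) = K₁·δ(t)^{m(m−1)}, and define w(t,x) = δ(t)·(sin(πx)+η(t))^{1/m} for t ≥ 0 and x ∈ [0,1]. Then for every t ≥ 0 and x ∈ [0,1], the partial derivative of w in t and the second partial derivative in x of x ↦ w(t,x)^m exist, and w satisfies the pointwise differential inequality ∂ₜw(t,x) − (A/m)·∂²ₓ(w(t,·)^m)(x) ≤ 0. -/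
theorem le_rpow_add_of_le_one {s e p : ℝ} (hs₀ : 0 ≤ s) (hs₁ : s ≤ 1) (he : 0 < e)
    (hp₀ : 0 ≤ p) (hp₁ : p ≤ 1) : s ≤ (s + e) ^ p := by
  rcases le_total (s + e) 1 with h | h
  · have := Real.rpow_le_rpow_of_exponent_ge (by linarith) h hp₁
    rw [Real.rpow_one] at this
    linarith
  · exact hs₁.trans (Real.one_le_rpow h hp₀)

/-- The separated amplitude `δ` solves `δ' = -K₃ δ ^ m`. -/
theorem hasDerivAt_porous_amplitude {m K₃ δ₀ t : ℝ} (hm : 1 < m) (hδ₀ : 0 < δ₀)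
    (ht : 0 < 1 + (m - 1) * K₃ * δ₀ ^ (m - 1) * t) :
    HasDerivAt (fun s => δ₀ * (1 + (m - 1) * K₃ * δ₀ ^ (m - 1) * s) ^ (-(1 / (m - 1))))
      (-K₃ * (δ₀ * (1 + (m - 1) * K₃ * δ₀ ^ (m - 1) * t) ^ (-(1 / (m - 1)))) ^ m) t := by
  have hm' : m - 1 ≠ 0 := by linarith
  have h := ((((hasDerivAt_id t).const_mul ((m - 1) * K₃ * δ₀ ^ (m - 1))).const_add 1).rpow_const
    (p := -(1 / (m - 1))) (Or.inl ht.ne')).const_mul δ₀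
  refine h.congr_deriv (Eq.symm ?_)
  have hexp : -(1 / (m - 1)) * m = -(1 / (m - 1)) - 1 := by field_simp; ring
  have hpow : δ₀ ^ m = δ₀ * δ₀ ^ (m - 1) := by
    rw [Real.rpow_sub_one hδ₀.ne']; field_simp
  rw [Real.mul_rpow hδ₀.le (by positivity), ← Real.rpow_mul ht.le, hexp, hpow]
  simp only [id]
  field_simp


/-- Fix `m > 1`, `A > 0`, `δ₀ > 0`, `K₁ > 0`. With `K₃ = Aπ²/m`,
`K = (m−1)K₃δ₀^{m−1}`, `δ(t) = δ₀(1+Kt)^{−1/(m−1)}`, `η(t) = K₁δ(t)^{m(m−1)}`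
and `w(t,x) = δ(t)(sin(πx)+η(t))^{1/m}`, for every `t ≥ 0` and `x ∈ [0,1]` the
partial derivative `∂ₜw(t,x)` and the second partial derivative
`∂²ₓ(w(t,·)^m)(x)` exist and `∂ₜw(t,x) − (A/m)·∂²ₓ(w(t,·)^m)(x) ≤ 0`
(real powers via `Real.rpow`). -/
theorem stmt_4 (m A δ₀ K₁ K₃ K : ℝ) (hm : 1 < m) (hA : 0 < A) (hδ₀ : 0 < δ₀)
    (hK₁ : 0 < K₁) (hK₃ : K₃ = A * Real.pi ^ 2 / m)
    (hK : K = (m - 1) * K₃ * δ₀ ^ (m - 1))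
    (δ η : ℝ → ℝ)
    (hδ : ∀ t : ℝ, δ t = δ₀ * (1 + K * t) ^ (-(1 / (m - 1))))
    (hη : ∀ t : ℝ, η t = K₁ * δ t ^ (m * (m - 1)))
    (w : ℝ → ℝ → ℝ)
    (hw : ∀ t x : ℝ, w t x = δ t * (Real.sin (Real.pi * x) + η t) ^ (1 / m)) :
    ∀ t : ℝ, 0 ≤ t → ∀ x ∈ Set.Icc (0 : ℝ) 1,
      DifferentiableAt ℝ (fun s => w s x) t ∧
      DifferentiableAt ℝ (fun y => w t y ^ m) x ∧
      DifferentiableAt ℝ (deriv fun y => w t y ^ m) x ∧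
      deriv (fun s => w s x) t - A / m * deriv (deriv fun y => w t y ^ m) x ≤ 0 := by
  intro t ht x hx
  have hm₀ : 0 < m := by linarith
  have hm₁ : 0 < m - 1 := by linarith
  have hK₃pos : 0 < K₃ := by rw [hK₃]; positivity
  have hKt : 0 < 1 + K * t := by
    have : 0 ≤ K := by rw [hK]; positivity
    positivity
  have hδpos : 0 < δ t := by rw [hδ]; positivity
  have hηpos : 0 < η t := by rw [hη]; positivity
  have hsin : 0 ≤ Real.sin (Real.pi * x) :=
    Real.sin_nonneg_of_nonneg_of_le_pi (mul_nonneg Real.pi_pos.le hx.1)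
      (mul_le_of_le_one_right Real.pi_pos.le hx.2)
  have hu : 0 < Real.sin (Real.pi * x) + η t := by linarith
  have hδ' : HasDerivAt δ (-K₃ * δ t ^ m) t := by
    have h := hasDerivAt_porous_amplitude (K₃ := K₃) (t := t) hm hδ₀ (by rw [← hK]; exact hKt)
    rw [← hK, ← hδ] at h
    exact h.congr_of_eventuallyEq (Filter.Eventually.of_forall hδ)
  obtain ⟨η', hη', hη'nonpos⟩ : ∃ η', HasDerivAt η η' t ∧ η' ≤ 0 := by
    refine ⟨_, ((hδ'.rpow_const (p := m * (m - 1)) (Or.inl hδpos.ne')).const_mul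
      K₁).congr_of_eventuallyEq (Filter.Eventually.of_forall hη), ?_⟩
    have : 0 ≤ K₁ * (K₃ * δ t ^ m * (m * (m - 1)) * δ t ^ (m * (m - 1) - 1)) := by positivity
    linarith
  have hwt := (hδ'.mul ((hη'.const_add (Real.sin (Real.pi * x))).rpow_const
    (p := 1 / m) (Or.inl hu.ne'))).congr_of_eventuallyEq
    (Filter.Eventually.of_forall fun s => hw s x)
  have hsx (y : ℝ) : HasDerivAt (fun y => Real.sin (Real.pi * y))
      (Real.cos (Real.pi * y) * Real.pi) y := by
    simpa using ((hasDerivAt_id y).const_mul Real.pi).sin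
  have hcx (y : ℝ) : HasDerivAt (fun y => Real.cos (Real.pi * y))
      (-Real.sin (Real.pi * y) * Real.pi) y := by
    simpa using ((hasDerivAt_id y).const_mul Real.pi).cos
  have hwm : (fun y => w t y ^ m) =ᶠ[nhds x]
      fun y => δ t ^ m * (Real.sin (Real.pi * y) + η t) := by
    have hcont : ContinuousAt (fun y => Real.sin (Real.pi * y) + η t) x := by fun_prop
    filter_upwards [hcont.eventually (lt_mem_nhds hu)] with y hy
    rw [hw, Real.mul_rpow hδpos.le (by positivity), ← Real.rpow_mul hy.le,
      one_div_mul_cancel hm₀.ne', Real.rpow_one]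
  have hd₁ (y : ℝ) := ((hsx y).add_const (η t)).const_mul (δ t ^ m)
  have hderiv := hwm.deriv
  rw [show deriv (fun y => δ t ^ m * (Real.sin (Real.pi * y) + η t)) =
    fun y => δ t ^ m * (Real.cos (Real.pi * y) * Real.pi) from funext fun y => (hd₁ y).deriv]
    at hderiv
  have hd₂ := (((hcx x).mul_const Real.pi).const_mul (δ t ^ m)).congr_of_eventuallyEq hderiv
  refine ⟨hwt.differentiableAt, ((hd₁ x).congr_of_eventuallyEq hwm).differentiableAt,
    hd₂.differentiableAt, ?_⟩
  rw [hwt.deriv, hd₂.deriv]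
  have hreaction : K₃ * δ t ^ m * Real.sin (Real.pi * x) ≤
      K₃ * δ t ^ m * (Real.sin (Real.pi * x) + η t) ^ (1 / m) :=
    mul_le_mul_of_nonneg_left
      (le_rpow_add_of_le_one hsin (Real.sin_le_one _) hηpos (by positivity)
        ((div_le_one hm₀).2 hm.le)) (by positivity)
  have hdecay : δ t * (η' * (1 / m) * (Real.sin (Real.pi * x) + η t) ^ (1 / m - 1)) ≤ 0 :=
    mul_nonpos_of_nonneg_of_nonpos hδpos.le
      (mul_nonpos_of_nonpos_of_nonneg
        (mul_nonpos_of_nonpos_of_nonneg hη'nonpos (by positivity)) (by positivity))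
  have hdiff : A / m * (δ t ^ m * (-Real.sin (Real.pi * x) * Real.pi * Real.pi)) =
      -(K₃ * δ t ^ m * Real.sin (Real.pi * x)) := by
    rw [hK₃]; ring
  rw [hdiff]
  linarith
end

section
/- Fix m > 1, A > 0, γ > 0, δ₀ > 0 and K₁ with 0 < K₁ ≤ (πA/(mγ))^m. Set K₃ = Aπ²/m, K = (m−1)·K₃·δ₀^{m−1}, δ(t) = δ₀·(1+Kt)^{−1/(m−1)}, η(t) = K₁·δ(t)^{m(m−1)}, and define w(t,x) = δ(t)·(sin(πx)+η(t))^{1/m} for t ≥ 0 and x ∈ [0,1]. Then for every t ≥ 0 the boundary inequalities −(A/m)·∂ₓ(w(t,·)^m)(0) + γ·w(t,0) ≤ 0 and (A/m)·∂ₓ(w(t,·)^m)(1) + γ·w(t,1) ≤ 0 hold. -/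
/-- Derivative of the `m`-th power of a positive multiple of `(sin (π x) + c) ^ (1 / m)`, at a point
where the base is positive. -/
theorem hasDerivAt_const_mul_sin_add_rpow_inv_rpow {m d c x : ℝ} (hm : m ≠ 0) (hd : 0 ≤ d)
    (hx : 0 < Real.sin (Real.pi * x) + c) :
    HasDerivAt (fun y => (d * (Real.sin (Real.pi * y) + c) ^ (1 / m)) ^ m)
      (d ^ m * (Real.cos (Real.pi * x) * Real.pi)) x := by
  have hlin : HasDerivAt (fun y : ℝ => Real.pi * y) Real.pi x := by
    simpa using (hasDerivAt_id x).const_mul Real.pi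
  refine ((hlin.sin.add_const c).const_mul (d ^ m)).congr_of_eventuallyEq ?_
  have hcont : ContinuousAt (fun y : ℝ => Real.sin (Real.pi * y) + c) x := by fun_prop
  filter_upwards [hcont.eventually (lt_mem_nhds hx)] with y hy
  rw [Real.mul_rpow hd (Real.rpow_nonneg hy.le _), ← Real.rpow_mul hy.le,
    one_div_mul_cancel hm, Real.rpow_one]


/-- Fix `m > 1`, `A > 0`, `γ > 0`, `δ₀ > 0`, `0 < K₁ ≤ (πA/(mγ))^m`. With
`K₃ = Aπ²/m`, `K = (m−1)K₃δ₀^{m−1}`, `δ(t) = δ₀(1+Kt)^{−1/(m−1)}`,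
`η(t) = K₁δ(t)^{m(m−1)}` and `w(t,x) = δ(t)(sin(πx)+η(t))^{1/m}`, for every
`t ≥ 0` the Robin boundary sub-solution inequalities
`−(A/m)·∂ₓ(w(t,·)^m)(0) + γ·w(t,0) ≤ 0` and
`(A/m)·∂ₓ(w(t,·)^m)(1) + γ·w(t,1) ≤ 0` hold (real powers via `Real.rpow`). -/
theorem stmt_5 (m A γ δ₀ K₁ K₃ K : ℝ) (hm : 1 < m) (hA : 0 < A) (hγ : 0 < γ)
    (hδ₀ : 0 < δ₀) (hK₁ : 0 < K₁)
    (hK₁' : K₁ ≤ (Real.pi * A / (m * γ)) ^ m)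
    (hK₃ : K₃ = A * Real.pi ^ 2 / m)
    (hK : K = (m - 1) * K₃ * δ₀ ^ (m - 1))
    (δ η : ℝ → ℝ)
    (hδ : ∀ t : ℝ, δ t = δ₀ * (1 + K * t) ^ (-(1 / (m - 1))))
    (hη : ∀ t : ℝ, η t = K₁ * δ t ^ (m * (m - 1)))
    (w : ℝ → ℝ → ℝ)
    (hw : ∀ t x : ℝ, w t x = δ t * (Real.sin (Real.pi * x) + η t) ^ (1 / m)) :
    ∀ t : ℝ, 0 ≤ t →
      -(A / m) * deriv (fun y => w t y ^ m) 0 + γ * w t 0 ≤ 0 ∧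
      A / m * deriv (fun y => w t y ^ m) 1 + γ * w t 1 ≤ 0 := by
  intro t ht
  have hm0 : 0 < m := by linarith
  have hm1 : 0 < m - 1 := by linarith
  have hK_nonneg : 0 ≤ K := by rw [hK, hK₃]; positivity
  have hδ_pos : 0 < δ t := by rw [hδ]; positivity
  have hη_pos : 0 < η t := by rw [hη]; positivity
  have hη_root : η t ^ (1 / m) = K₁ ^ (1 / m) * δ t ^ (m - 1) := by
    rw [hη, Real.mul_rpow hK₁.le (by positivity), ← Real.rpow_mul hδ_pos.le]
    congr 2
    field_simp
  have hK₁_root : K₁ ^ (1 / m) ≤ Real.pi * A / (m * γ) := by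
    rw [one_div]
    exact (Real.rpow_inv_le_iff_of_pos hK₁.le (by positivity) hm0).2 hK₁'
  have hδ_pow : δ t * δ t ^ (m - 1) = δ t ^ m := by
    rw [Real.rpow_sub_one hδ_pos.ne']
    field_simp
  have hflux : γ * (δ t * η t ^ (1 / m)) ≤ A / m * (δ t ^ m * Real.pi) := by
    calc γ * (δ t * η t ^ (1 / m)) = γ * K₁ ^ (1 / m) * δ t ^ m := by
          rw [hη_root, ← hδ_pow]; ring
      _ ≤ γ * (Real.pi * A / (m * γ)) * δ t ^ m := by gcongr
      _ = A / m * (δ t ^ m * Real.pi) := by field_simp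
  have hderiv (x : ℝ) (hx : Real.sin (Real.pi * x) = 0) :
      deriv (fun y => w t y ^ m) x = δ t ^ m * (Real.cos (Real.pi * x) * Real.pi) := by
    simp only [hw]
    exact (hasDerivAt_const_mul_sin_add_rpow_inv_rpow hm0.ne' hδ_pos.le
      (by rw [hx]; linarith)).deriv
  rw [hderiv 0 (by simp), hderiv 1 (by simp), hw, hw]
  simp only [mul_zero, mul_one, Real.sin_zero, Real.sin_pi, Real.cos_zero, Real.cos_pi, zero_add]
  constructor <;> linarith
end

section
/- Fix m > 1, A > 0, δ₀ ∈ (0,1] and K₁ > 0. Set K₃ = Aπ²/m, δ(t) = δ₀·e^{−K₃t}, η(t) = K₁·δ(t)^{m(m−1)}, and define w(t,x) = δ(t)·(sin(πx)+η(t))^{1/m} for t ≥ 0 and x ∈ [0,1]. Then for every t ≥ 0 and x ∈ [0,1], the partial derivative of w in t and the second partial derivative in x of x ↦ w(t,x)^m exist, and w satisfies the pointwise differential inequality ∂ₜw(t,x) − (A/m)·∂²ₓ(w(t,·)^m)(x) ≤ 0; moreover w(t,x) ≥ K₁^{1/m}·δ₀^m·e^{−mK₃t} for all t ≥ 0 and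 x ∈ [0,1]. -/
open Filter Topology

/-- Time derivative of `δ (S + K δ ^ (m (m - 1))) ^ (1 / m)` when `δ' = -k δ`. -/
lemma hasDerivAt_mul_add_rpow {m k K S t : ℝ} {δ : ℝ → ℝ} (hm : m ≠ 0)
    (hδ : 0 < δ t) (hδ' : HasDerivAt δ (-k * δ t) t)
    (hS : 0 < S + K * δ t ^ (m * (m - 1))) :
    HasDerivAt (fun s => δ s * (S + K * δ s ^ (m * (m - 1))) ^ (1 / m))
      (-(k * δ t * ((S + K * δ t ^ (m * (m - 1))) ^ (1 / m - 1) *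
        (S + m * (K * δ t ^ (m * (m - 1))))))) t := by
  have hη : HasDerivAt (fun s => S + K * δ s ^ (m * (m - 1)))
      (-(m * (m - 1) * k) * (K * δ t ^ (m * (m - 1)))) t := by
    refine (((hδ'.rpow_const (p := m * (m - 1)) (Or.inl hδ.ne')).const_mul K).const_add
      S).congr_deriv ?_
    rw [Real.rpow_sub_one hδ.ne']
    field_simp
  refine (hδ'.mul (hη.rpow_const (p := 1 / m) (Or.inl hS.ne'))).congr_deriv ?_
  rw [Real.rpow_sub_one hS.ne']
  field_simp
  ring

lemma hasDerivAt_const_mul_sin_add (c e a y : ℝ) :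
    HasDerivAt (fun z => c * (Real.sin (a * z) + e)) (c * a * Real.cos (a * y)) y := by
  refine ((((hasDerivAt_id y).const_mul a).sin.add_const e).const_mul c).congr_deriv ?_
  simp only [id]
  ring

lemma hasDerivAt_const_mul_cos (c a y : ℝ) :
    HasDerivAt (fun z => c * Real.cos (a * z)) (-(c * a * Real.sin (a * y))) y := by
  refine ((((hasDerivAt_id y).const_mul a).cos).const_mul c).congr_deriv ?_
  simp only [id]
  ring

lemma rpow_mul_le_mul_add_rpow {m d S e : ℝ} (hm : 1 < m) (hd : 0 < d) (hd' : d ≤ 1)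
    (hS : 0 ≤ S) (hS' : S ≤ 1) (he : 0 < e) :
    d ^ m * S ≤ d * ((S + e) ^ (1 / m - 1) * (S + m * e)) := by
  have hpos : 0 < S + e := by linarith
  have hdm : d ^ m ≤ d := by
    simpa using Real.rpow_le_rpow_of_exponent_ge hd hd' hm.le
  have hS1 : S ≤ S ^ (1 / m) := by
    rcases hS.eq_or_lt with rfl | h
    · positivity
    · simpa using Real.rpow_le_rpow_of_exponent_ge h hS'
        ((div_le_one (by linarith)).2 hm.le)
  have hS2 : S ^ (1 / m) ≤ (S + e) ^ (1 / m) :=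
    Real.rpow_le_rpow hS (by linarith) (by positivity)
  have hsplit : (S + e) ^ (1 / m) = (S + e) ^ (1 / m - 1) * (S + e) := by
    rw [Real.rpow_sub_one hpos.ne']
    field_simp
  have hme : S + e ≤ S + m * e := by nlinarith
  calc d ^ m * S ≤ d * S := by gcongr
    _ ≤ d * ((S + e) ^ (1 / m - 1) * (S + e)) := by
        rw [← hsplit]
        exact mul_le_mul_of_nonneg_left (hS1.trans hS2) hd.le
    _ ≤ _ := by gcongr

/-- Fix `m > 1`, `A > 0`, `δ₀ ∈ (0,1]`, `K₁ > 0`. With `K₃ = Aπ²/m`,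
`δ(t) = δ₀·e^{−K₃t}`, `η(t) = K₁δ(t)^{m(m−1)}` and
`w(t,x) = δ(t)(sin(πx)+η(t))^{1/m}`, for every `t ≥ 0` and `x ∈ [0,1]` the
partial derivative `∂ₜw(t,x)` and the second partial derivative
`∂²ₓ(w(t,·)^m)(x)` exist, `∂ₜw(t,x) − (A/m)·∂²ₓ(w(t,·)^m)(x) ≤ 0`, and
moreover `w(t,x) ≥ K₁^{1/m}·δ₀^m·e^{−mK₃t}` (real powers via `Real.rpow`). -/
theorem stmt_19 (m A δ₀ K₁ K₃ : ℝ) (hm : 1 < m) (hA : 0 < A) (hδ₀ : 0 < δ₀)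
    (hδ₀' : δ₀ ≤ 1) (hK₁ : 0 < K₁) (hK₃ : K₃ = A * Real.pi ^ 2 / m)
    (δ η : ℝ → ℝ)
    (hδ : ∀ t : ℝ, δ t = δ₀ * Real.exp (-K₃ * t))
    (hη : ∀ t : ℝ, η t = K₁ * δ t ^ (m * (m - 1)))
    (w : ℝ → ℝ → ℝ)
    (hw : ∀ t x : ℝ, w t x = δ t * (Real.sin (Real.pi * x) + η t) ^ (1 / m)) :
    ∀ t : ℝ, 0 ≤ t → ∀ x ∈ Set.Icc (0 : ℝ) 1,
      DifferentiableAt ℝ (fun s => w s x) t ∧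
      DifferentiableAt ℝ (fun y => w t y ^ m) x ∧
      DifferentiableAt ℝ (deriv fun y => w t y ^ m) x ∧
      deriv (fun s => w s x) t - A / m * deriv (deriv fun y => w t y ^ m) x ≤ 0 ∧
      K₁ ^ (1 / m) * δ₀ ^ m * Real.exp (-(m * K₃) * t) ≤ w t x := by
  have hm0 : 0 < m := by linarith
  have hK₃0 : 0 < K₃ := by rw [hK₃]; positivity
  intro t ht x hx
  have hδpos : ∀ s, 0 < δ s := fun s => by rw [hδ]; positivity
  have hδle : δ t ≤ 1 := by
    rw [hδ]
    exact mul_le_one₀ hδ₀' (Real.exp_pos _).le (Real.exp_le_one_iff.2 (by nlinarith))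
  have hηpos : 0 < η t := by
    rw [hη]
    exact mul_pos hK₁ (Real.rpow_pos_of_pos (hδpos t) _)
  have hS : 0 ≤ Real.sin (Real.pi * x) :=
    Real.sin_nonneg_of_nonneg_of_le_pi (mul_nonneg Real.pi_pos.le hx.1)
      (mul_le_of_le_one_right Real.pi_pos.le hx.2)
  have hpos : 0 < Real.sin (Real.pi * x) + η t := by linarith
  have hδ' : HasDerivAt δ (-K₃ * δ t) t := by
    rw [funext hδ]
    refine ((((hasDerivAt_id t).const_mul (-K₃)).exp).const_mul δ₀).congr_deriv ?_
    simp only [id]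
    ring
  have hwt : HasDerivAt (fun s => w s x) (-(K₃ * δ t *
      ((Real.sin (Real.pi * x) + η t) ^ (1 / m - 1) *
        (Real.sin (Real.pi * x) + m * η t)))) t := by
    simp only [hw, hη] at hpos ⊢
    exact hasDerivAt_mul_add_rpow hm0.ne' (hδpos t) hδ' hpos
  have hwm : (fun y => w t y ^ m) =ᶠ[𝓝 x]
      fun y => δ t ^ m * (Real.sin (Real.pi * y) + η t) := by
    have hcont : ContinuousAt (fun y => Real.sin (Real.pi * y) + η t) x := by fun_prop
    filter_upwards [hcont.eventually (lt_mem_nhds hpos)] with y hy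
    rw [hw, Real.mul_rpow (hδpos t).le (by positivity), one_div,
      Real.rpow_inv_rpow hy.le hm0.ne']
  have hwx : HasDerivAt (fun y => w t y ^ m) _ x :=
    (hasDerivAt_const_mul_sin_add (δ t ^ m) (η t) Real.pi x).congr_of_eventuallyEq hwm
  have hwxx : HasDerivAt (deriv fun y => w t y ^ m) _ x :=
    (hasDerivAt_const_mul_cos (δ t ^ m * Real.pi) Real.pi x).congr_of_eventuallyEq
      (hwm.deriv.trans (Eventually.of_forall fun y =>
        (hasDerivAt_const_mul_sin_add (δ t ^ m) (η t) Real.pi y).deriv))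
  refine ⟨hwt.differentiableAt, hwx.differentiableAt, hwxx.differentiableAt, ?_, ?_⟩
  · rw [hwt.deriv, hwxx.deriv]
    have key := mul_le_mul_of_nonneg_left
      (rpow_mul_le_mul_add_rpow hm (hδpos t) hδle hS (Real.sin_le_one _) hηpos) hK₃0.le
    have hflux : A / m * -(δ t ^ m * Real.pi * Real.pi * Real.sin (Real.pi * x)) =
        -(K₃ * (δ t ^ m * Real.sin (Real.pi * x))) := by
      rw [hK₃]
      ring
    rw [hflux]
    linarith
  · have hδm : δ₀ ^ m * Real.exp (-(m * K₃) * t) = δ t ^ m := by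
      rw [hδ, Real.mul_rpow hδ₀.le (Real.exp_pos _).le, ← Real.exp_mul]
      ring_nf
    have hηm : δ t * η t ^ (1 / m) = K₁ ^ (1 / m) * δ t ^ m := by
      have hexp : m * (m - 1) * (1 / m) = m - 1 := by field_simp
      rw [hη, Real.mul_rpow hK₁.le (Real.rpow_nonneg (hδpos t).le _),
        ← Real.rpow_mul (hδpos t).le, hexp, Real.rpow_sub_one (hδpos t).ne']
      field_simp [(hδpos t).ne']
    rw [mul_assoc, hδm, ← hηm, hw]
    exact mul_le_mul_of_nonneg_left
      (Real.rpow_le_rpow hηpos.le (by linarith) (by positivity)) (hδpos t).le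
end
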